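/- arXiv:2410.22509 — 2 statements merged into one kernel-verified Lean document; each statement's English description precedes it below -/
import Mathlib

section
/- Let (X, μ) be a measure space with μ σ-finite, p : X → [1,∞) measurable, and φ : X → X a measurable non-singular map whose pushforward measure E ↦ μ(φ⁻¹(E)) is σ-finite, with Radon–Nikodym derivative u_φ. If there is a constant K ≥ 0 with u_φ(x)^{1/p(x)} ≤ K for μ-a.e. x ∈ X, then for every measurable f : X → ℝ one has ‖f∘φ‖_{(p∘φ)(·)} ≤ K · ‖f‖_{p(·)}, where the Luxemburg norms are taken with respect to the exponents p∘φ and p respectively. -/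
open MeasureTheory Metric Filter ENNReal

/-- The Luxemburg norm associated with a variable exponent `q`
(with the convention `inf ∅ = ∞`). -/
noncomputable def luxNorm {X : Type*} [MeasurableSpace X]
    (μ : Measure X) (q : X → ℝ) (f : X → ℝ) : ℝ≥0∞ :=
  sInf {η : ℝ≥0∞ | ∫⁻ x, (ENNReal.ofReal |f x| / η) ^ q x ∂μ ≤ 1}

/-- Let `(X,μ)` be a σ-finite measure space, `p : X → [1,∞)` measurable, and `φ` a measurable
non-singular map with σ-finite pushforward and Radon–Nikodym derivative `u`. If
`u(x)^{1/p(x)} ≤ K` a.e., then `‖f∘φ‖_{(p∘φ)(·)} ≤ K·‖f‖_{p(·)}` for every measurable `f`. -/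
theorem statement10
    {X : Type*} [MeasurableSpace X]
    (μ : Measure X) [SigmaFinite μ]
    (p : X → ℝ) (hp_meas : Measurable p) (hp1 : ∀ x, 1 ≤ p x)
    (φ : X → X) (hφ : Measurable φ)
    (hns : ∀ E : Set X, MeasurableSet E → μ E = 0 → μ (φ ⁻¹' E) = 0)
    [SigmaFinite (μ.map φ)]
    (u : X → ℝ≥0∞) (hu_meas : Measurable u)
    (hu : ∀ E : Set X, MeasurableSet E → μ (φ ⁻¹' E) = ∫⁻ x in E, u x ∂μ)
    (K : ℝ) (hK : 0 ≤ K)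
    (hbound : ∀ᵐ x ∂μ, u x ^ (1 / p x) ≤ ENNReal.ofReal K) :
    ∀ f : X → ℝ, Measurable f →
      luxNorm μ (fun x => p (φ x)) (fun x => f (φ x)) ≤ ENNReal.ofReal K * luxNorm μ p f := by
  intro f hf
  have hmap : μ.map φ = μ.withDensity u := by
    ext E hE
    rw [Measure.map_apply hφ hE, withDensity_apply _ hE, hu E hE]
  have hu_le : ∀ᵐ x ∂μ, u x ≤ ENNReal.ofReal K ^ p x := by
    filter_upwards [hbound] with x hx
    have hpx : 0 < p x := zero_lt_one.trans_le (hp1 x)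
    rwa [one_div, ENNReal.rpow_inv_le_iff hpx] at hx
  rcases hK.eq_or_lt with rfl | hK
  · have hu0 : ∀ᵐ x ∂μ, u x = 0 := by
      filter_upwards [hu_le] with x hx
      have hpx : 0 < p x := zero_lt_one.trans_le (hp1 x)
      simpa [ENNReal.zero_rpow_of_pos hpx] using hx
    have hμ : μ = 0 := by
      rw [← Measure.measure_univ_eq_zero, ← Set.preimage_univ (f := φ), hu _ .univ,
        Measure.restrict_univ, lintegral_congr_ae hu0, lintegral_zero]
    have : luxNorm μ (fun x => p (φ x)) (fun x => f (φ x)) ≤ 0 :=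
      sInf_le (by simp [hμ])
    exact this.trans zero_le
  have hK0 : ENNReal.ofReal K ≠ 0 := by simpa using hK
  have hKtop : ENNReal.ofReal K ≠ ∞ := ofReal_ne_top
  rw [mul_comm, ← ENNReal.div_le_iff hK0 hKtop]
  refine le_sInf fun η hη => ?_
  rw [ENNReal.div_le_iff hK0 hKtop]
  refine sInf_le ?_
  have hg : Measurable fun x => (ENNReal.ofReal |f x| / (η * ENNReal.ofReal K)) ^ p x := by
    fun_prop
  calc ∫⁻ x, (ENNReal.ofReal |f (φ x)| / (η * ENNReal.ofReal K)) ^ p (φ x) ∂μ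
      = ∫⁻ x, u x * (ENNReal.ofReal |f x| / (η * ENNReal.ofReal K)) ^ p x ∂μ := by
        rw [← lintegral_map hg hφ, hmap, lintegral_withDensity_eq_lintegral_mul _ hu_meas hg]
        rfl
    _ ≤ ∫⁻ x, (ENNReal.ofReal |f x| / η) ^ p x ∂μ := by
        refine lintegral_mono_ae ?_
        filter_upwards [hu_le] with x hx
        have hpx : 0 ≤ p x := zero_le_one.trans (hp1 x)
        refine (mul_le_mul_left hx _).trans_eq ?_
        rw [← ENNReal.mul_rpow_of_nonneg _ _ hpx, div_eq_mul_inv,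
          ENNReal.mul_inv (.inr hKtop) (.inr hK0), mul_comm, mul_assoc, mul_assoc,
          ENNReal.inv_mul_cancel hK0 hKtop, mul_one, ← div_eq_mul_inv]
    _ ≤ 1 := hη
end

section
/- Let (X,d) be a proper separable metric space and μ a doubling Borel measure on X that is positive on nonempty open sets and finite on bounded sets. Let p : X → [1,∞) be measurable and φ : X → X a non-singular Borel map whose pushforward measure E ↦ μ(φ⁻¹(E)) is σ-finite, with Radon–Nikodym derivative u_φ. If there is a constant C > 0 such that ‖f∘φ‖_{(p∘φ)(·)} ≤ C · ‖f‖_{p(·)} for every measurable f with ‖f‖_{p(·)} < ∞, then u_φ(x) ≤ C^{p(x)} for μ-a.e. x ∈ X; in particular u_φ(·)^{1/p(·)} is essentially bounded by C. -/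
open MeasureTheory Metric Filter ENNReal

/-- The modular is at most one at every level above the Luxemburg norm. -/
lemma lintegral_rpow_le_one_of_luxNorm_lt {X : Type*} [MeasurableSpace X] {μ : Measure X}
    {q f : X → ℝ} (hq : ∀ x, 0 ≤ q x) {η : ℝ≥0∞} (h : luxNorm μ q f < η) :
    ∫⁻ x, (ENNReal.ofReal |f x| / η) ^ q x ∂μ ≤ 1 := by
  obtain ⟨ξ, hξ, hlt⟩ := sInf_lt_iff.mp h
  refine le_trans (lintegral_mono fun x => ?_) hξ
  exact ENNReal.rpow_le_rpow (ENNReal.div_le_div_left hlt.le _) (hq x)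

/-- The indicator of `E` normalized to have modular one for the exponent `p`. -/
noncomputable def normalizedIndicator {X : Type*} [MeasurableSpace X] (μ : Measure X)
    (p : X → ℝ) (E : Set X) : X → ℝ :=
  E.indicator fun x => (μ E).toReal ^ (-(1 / p x))

lemma measurable_normalizedIndicator {X : Type*} [MeasurableSpace X] (μ : Measure X)
    {p : X → ℝ} (hp : Measurable p) {E : Set X} (hE : MeasurableSet E) :
    Measurable (normalizedIndicator μ p E) :=
  (measurable_const.pow ((measurable_const.div hp).neg)).indicator hE

lemma normalizedIndicator_div_rpow {X : Type*} [MeasurableSpace X] {μ : Measure X}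
    {p : X → ℝ} {E : Set X} (h0 : μ E ≠ 0) (htop : μ E ≠ ∞) (η : ℝ≥0∞) {x : X}
    (hp : 0 < p x) :
    (ENNReal.ofReal |normalizedIndicator μ p E x| / η) ^ p x =
      E.indicator (fun y => (μ E)⁻¹ * (η ^ p y)⁻¹) x := by
  by_cases hx : x ∈ E
  · have hpos : 0 < (μ E).toReal := ENNReal.toReal_pos h0 htop
    rw [normalizedIndicator, Set.indicator_of_mem hx, Set.indicator_of_mem hx,
      abs_of_nonneg (Real.rpow_nonneg hpos.le _), ← ENNReal.ofReal_rpow_of_pos hpos,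
      ENNReal.ofReal_toReal htop, ENNReal.div_rpow_of_nonneg _ _ hp.le, ← ENNReal.rpow_mul,
      neg_mul, one_div_mul_cancel hp.ne', ENNReal.rpow_neg_one, div_eq_mul_inv]
  · simp [normalizedIndicator, hx, hp]

lemma luxNorm_normalizedIndicator_le_one {X : Type*} [MeasurableSpace X] {μ : Measure X}
    {p : X → ℝ} (hp : ∀ x, 0 < p x) {E : Set X} (hE : MeasurableSet E) (h0 : μ E ≠ 0)
    (htop : μ E ≠ ∞) : luxNorm μ p (normalizedIndicator μ p E) ≤ 1 := by
  refine sInf_le ?_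
  change ∫⁻ x, _ ∂μ ≤ 1
  simp_rw [fun x => normalizedIndicator_div_rpow h0 htop 1 (hp x)]
  simp [lintegral_indicator hE, ENNReal.inv_mul_cancel h0 htop]

/-- Boundedness of composition by `φ` on normalized indicators controls the density of `φ`. -/
lemma ae_le_rpow_of_luxNorm_comp_le {X : Type*} [MeasurableSpace X] {μ : Measure X}
    [SigmaFinite μ] {p : X → ℝ} (hp : Measurable p) (hp0 : ∀ x, 0 < p x) {φ : X → X}
    (hφ : Measurable φ) {u : X → ℝ≥0∞} (hu : Measurable u)
    (hmap : μ.map φ = μ.withDensity u) {c : ℝ≥0∞}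
    (hbound : ∀ f : X → ℝ, Measurable f → luxNorm μ p f ≤ 1 →
      luxNorm μ (fun x => p (φ x)) (fun x => f (φ x)) < c) (hc : c ≠ ∞) :
    ∀ᵐ x ∂μ, u x ≤ c ^ p x := by
  rcases eq_or_ne c 0 with rfl | hc0
  · exact absurd (hbound 0 measurable_zero (sInf_le (by simp [fun x => hp0 x]))) (by simp)
  have hw : Measurable fun x => (c ^ p x)⁻¹ := (measurable_const.pow hp).inv
  suffices h : (fun x => u x * (c ^ p x)⁻¹) ≤ᵐ[μ] fun _ => 1 by
    filter_upwards [h] with x hx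
    have hx' : u x / c ^ p x ≤ 1 := by rwa [div_eq_mul_inv]
    simpa using (ENNReal.div_le_iff (ENNReal.rpow_pos (pos_iff_ne_zero.2 hc0) hc).ne'
      (ENNReal.rpow_ne_top_of_nonneg (hp0 x).le hc)).1 hx'
  refine ae_le_of_forall_setLIntegral_le_of_sigmaFinite (hu.mul hw) fun E hE htop => ?_
  rcases eq_or_ne (μ E) 0 with h0 | h0
  · simp [Measure.restrict_eq_zero.2 h0]
  have hmod := lintegral_rpow_le_one_of_luxNorm_lt (fun x => (hp0 (φ x)).le)
    (hbound _ (measurable_normalizedIndicator μ hp hE)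
      (luxNorm_normalizedIndicator_le_one hp0 hE h0 htop.ne))
  simp_rw [fun x => normalizedIndicator_div_rpow h0 htop.ne c (hp0 (φ x))] at hmod
  rw [← lintegral_map (f := E.indicator fun y => (μ E)⁻¹ * (c ^ p y)⁻¹)
    ((hw.const_mul _).indicator hE) hφ, lintegral_indicator hE,
    lintegral_const_mul _ hw, hmap, setLIntegral_withDensity_eq_setLIntegral_mul _ hu hw hE,
    mul_comm, ← div_eq_mul_inv, ENNReal.div_le_iff h0 htop.ne] at hmod
  simpa using hmod

/-- Let `(X,d)` be a proper separable metric space, `μ` a doubling Borel measure positive on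
nonempty open sets and finite on bounded sets, `p : X → [1,∞)` measurable, and `φ` a
non-singular Borel map with σ-finite pushforward and Radon–Nikodym derivative `u`. If
`‖f∘φ‖_{(p∘φ)(·)} ≤ C·‖f‖_{p(·)}` for every measurable `f` with finite norm, then
`u(x) ≤ C^{p(x)}` for `μ`-a.e. `x`; in particular `u^{1/p(·)}` is essentially bounded by `C`. -/
theorem statement11
    {X : Type*} [MetricSpace X] [ProperSpace X] [TopologicalSpace.SeparableSpace X]
    [MeasurableSpace X] [BorelSpace X]
    (μ : Measure X) [μ.IsOpenPosMeasure]
    (hfin : ∀ s : Set X, Bornology.IsBounded s → μ s < ∞)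
    (C_d : NNReal) (hdb : ∀ (x : X) (r : ℝ), 0 < r → μ (ball x (2 * r)) ≤ C_d * μ (ball x r))
    (p : X → ℝ) (hp_meas : Measurable p) (hp1 : ∀ x, 1 ≤ p x)
    (φ : X → X) (hφ : Measurable φ)
    (hns : ∀ E : Set X, MeasurableSet E → μ E = 0 → μ (φ ⁻¹' E) = 0)
    [SigmaFinite (μ.map φ)]
    (u : X → ℝ≥0∞) (hu_meas : Measurable u)
    (hu : ∀ E : Set X, MeasurableSet E → μ (φ ⁻¹' E) = ∫⁻ x in E, u x ∂μ)
    (C : ℝ) (hC : 0 < C)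
    (hbound : ∀ f : X → ℝ, Measurable f → luxNorm μ p f < ∞ →
      luxNorm μ (fun x => p (φ x)) (fun x => f (φ x)) ≤ ENNReal.ofReal C * luxNorm μ p f) :
    (∀ᵐ x ∂μ, u x ≤ ENNReal.ofReal (C ^ p x)) ∧
      (∀ᵐ x ∂μ, u x ^ (1 / p x) ≤ ENNReal.ofReal C) := by
  have : IsFiniteMeasureOnCompacts μ := ⟨fun K hK => hfin K hK.isBounded⟩
  have hp0 : ∀ x, 0 < p x := fun x => one_pos.trans_le (hp1 x)
  have hmap : μ.map φ = μ.withDensity u := by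
    ext E hE
    rw [Measure.map_apply hφ hE, withDensity_apply _ hE, hu E hE]
  have happrox : ∀ n : ℕ, ∀ᵐ x ∂μ, u x ≤ ENNReal.ofReal (C + 1 / (n + 1)) ^ p x := fun n => by
    refine ae_le_rpow_of_luxNorm_comp_le hp_meas hp0 hφ hu_meas hmap (fun f hf hf1 => ?_)
      ENNReal.ofReal_ne_top
    refine (hbound f hf (hf1.trans_lt one_lt_top)).trans_lt ?_
    refine (mul_le_of_le_one_right' hf1).trans_lt ?_
    have hn : (0 : ℝ) < 1 / (n + 1) := Nat.one_div_pos_of_nat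
    exact (ENNReal.ofReal_lt_ofReal_iff (by linarith)).2 (by linarith)
  have hmain : ∀ᵐ x ∂μ, u x ≤ ENNReal.ofReal C ^ p x := by
    filter_upwards [ae_all_iff.2 happrox] with x hx
    have hlim : Tendsto (fun n : ℕ => C + 1 / ((n : ℝ) + 1)) atTop (nhds C) := by
      simpa using tendsto_one_div_add_atTop_nhds_zero_nat.const_add C
    exact ge_of_tendsto' ((ENNReal.continuous_rpow_const.tendsto _).comp
      (ENNReal.tendsto_ofReal hlim)) hx
  constructor
  · filter_upwards [hmain] with x hx
    rwa [← ENNReal.ofReal_rpow_of_pos hC]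
  · filter_upwards [hmain] with x hx
    rwa [one_div, ENNReal.rpow_inv_le_iff (hp0 x)]
end
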